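/- arXiv:1311.2298 — 2 statements merged into one kernel-verified Lean document; each statement's English description precedes it below -/
import Mathlib

section
/- Let ℬ ⊆ 𝒫(n) be a simply rooted family, let |ℬ| = m, and let m' be the number of sets B ∈ ℬ with d_ℬ(B) = B. Then ‖ℬ‖ ≤ ‖I(m)‖ + m − m'. -/
open Finset
open scoped Classical

/-- The total size `‖𝒜‖ = Σ_{A∈𝒜} |A|` of a family of finite sets. -/
def totalSize (𝒜 : Finset (Finset ℕ)) : ℕ := ∑ A ∈ 𝒜, A.card

/-- A family is union-closed if it is closed under pairwise unions. -/
def UnionClosed (𝒜 : Finset (Finset ℕ)) : Prop := ∀ A ∈ 𝒜, ∀ B ∈ 𝒜, A ∪ B ∈ 𝒜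

/-- The `k`-th finite set of positive integers in the colex order: the positive
integer `i` belongs to it iff bit `i - 1` of `k` is set. -/
def colexSet (k : ℕ) : Finset ℕ :=
  ((Finset.range (k + 1)).filter fun i => k.testBit i).image (· + 1)

/-- The initial segment `I(m)` of length `m` of the colex order on finite sets
of positive integers. -/
def colexInit (m : ℕ) : Finset (Finset ℕ) := (Finset.range m).image colexSet

/-- A family `ℬ` is simply rooted if every nonempty `B ∈ ℬ` has some `b ∈ B`
with the whole cube `[{b}, B]` contained in `ℬ`. -/
def SimplyRooted (ℬ : Finset (Finset ℕ)) : Prop :=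
  ∀ B ∈ ℬ, B.Nonempty → ∃ b ∈ B, ∀ C : Finset ℕ, {b} ⊆ C → C ⊆ B → C ∈ ℬ

/-- `B` is `ℬ`-rooted at `i`: `i ∈ B` and the cube `[{i}, B]` lies in `ℬ`. -/
def RootedAt (ℬ : Finset (Finset ℕ)) (B : Finset ℕ) (i : ℕ) : Prop :=
  i ∈ B ∧ ∀ C : Finset ℕ, {i} ⊆ C → C ⊆ B → C ∈ ℬ

/-- `ℬ_S`: the sets of `ℬ` that are `ℬ`-rooted at some element of `S`. -/
noncomputable def rootedFam (ℬ : Finset (Finset ℕ)) (S : Finset ℕ) : Finset (Finset ℕ) :=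
  ℬ.filter fun B => ∃ i ∈ S, RootedAt ℬ B i

/-- The image of a single set `B` under the down-compression of `ℬ` in
direction `i`. -/
def compressSet (ℬ : Finset (Finset ℕ)) (i : ℕ) (B : Finset ℕ) : Finset ℕ :=
  if i ∈ B ∧ B.erase i ∉ ℬ then B.erase i else B

/-- The down-compression `d_i(ℬ)` of the family `ℬ` in direction `i`. -/
def dComp (i : ℕ) (ℬ : Finset (Finset ℕ)) : Finset (Finset ℕ) :=
  ℬ.image (compressSet ℬ i)

/-- `D_k(ℬ) = d_k(⋯ d_1(ℬ) ⋯)`.  In particular `d(ℬ) = D_n(ℬ)` for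
`ℬ ⊆ 𝒫(n)`. -/
def DComp : ℕ → Finset (Finset ℕ) → Finset (Finset ℕ)
  | 0, ℬ => ℬ
  | k + 1, ℬ => dComp (k + 1) (DComp k ℬ)

/-- `D_{(ℬ,k)}(B)`: the image of the set `B` obtained by following `B` through
the successive compressions `d_1, …, d_k`.  In particular `d_ℬ(B) = D_{(ℬ,n)}(B)`
for `ℬ ⊆ 𝒫(n)`. -/
def DCompSet : ℕ → Finset (Finset ℕ) → Finset ℕ → Finset ℕ
  | 0, _, B => B
  | k + 1, ℬ, B => compressSet (DComp k ℬ) (k + 1) (DCompSet k ℬ B)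

/-- The shadow `δB = {B \ {i} : i ∈ B}` of a finite set `B`. -/
def shadowSet (B : Finset ℕ) : Finset (Finset ℕ) := B.image fun i => B.erase i

/-- `B` is a bad set of `ℬ ⊆ 𝒫(n)` if `δB ⊆ ℬ` or `d_ℬ(B) = B`. -/
def BadSet (n : ℕ) (ℬ : Finset (Finset ℕ)) (B : Finset ℕ) : Prop :=
  shadowSet B ⊆ ℬ ∨ DCompSet n ℬ B = B

/-- A family is a down-set if it is closed under taking subsets. -/
def IsDownSet (𝒟 : Finset (Finset ℕ)) : Prop := ∀ A ∈ 𝒟, ∀ B ⊆ A, B ∈ 𝒟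

/-- The deficiency `def(ℬ) = Σ_{B∈ℬ} |δB \ ℬ|`. -/
def deficiency (ℬ : Finset (Finset ℕ)) : ℕ := ∑ B ∈ ℬ, (shadowSet B \ ℬ).card

/-- `𝒜 ⊆ 𝒫(n)` is a counterexample to the union-closed conjecture:
union-closed, not `{∅}`, and every element of `[n]` has degree `< |𝒜|/2`. -/
def UCCounterexample (n : ℕ) (𝒜 : Finset (Finset ℕ)) : Prop :=
  𝒜 ⊆ (Finset.Icc 1 n).powerset ∧ UnionClosed 𝒜 ∧ 𝒜 ≠ {∅} ∧
    ∀ i ∈ Finset.Icc 1 n, ((𝒜.filter fun A => i ∈ A).card : ℚ) < (𝒜.card : ℚ) / 2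

theorem mem_dComp (i : ℕ) (F : Finset (Finset ℕ)) (A : Finset ℕ) :
    A ∈ dComp i F ↔ (i ∈ A ∧ A ∈ F ∧ A.erase i ∈ F) ∨ (i ∉ A ∧ (A ∈ F ∨ insert i A ∈ F)) := by
  simp only [dComp, Finset.mem_image, compressSet]
  constructor
  · rintro ⟨B, hB, rfl⟩
    split_ifs with h
    · exact Or.inr ⟨Finset.notMem_erase _ _, Or.inr (by rwa [Finset.insert_erase h.1])⟩
    · by_cases hi : i ∈ B
      · exact Or.inl ⟨hi, hB, by by_contra h'; exact h ⟨hi, h'⟩⟩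
      · exact Or.inr ⟨hi, Or.inl hB⟩
  · rintro (⟨hi, hA, hA'⟩ | ⟨hi, hA⟩)
    · exact ⟨A, hA, if_neg fun h => h.2 hA'⟩
    · by_cases hAF : A ∈ F
      · exact ⟨A, hAF, if_neg fun h => hi h.1⟩
      · have hins := hA.resolve_left hAF
        refine ⟨insert i A, hins, ?_⟩
        rw [Finset.erase_insert hi, if_pos ⟨Finset.mem_insert_self _ _, hAF⟩]

theorem compressSet_injOn (i : ℕ) (F : Finset (Finset ℕ)) :
    Set.InjOn (compressSet F i) (F : Set (Finset ℕ)) := by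
  intro A hA B hB h
  rw [Finset.mem_coe] at hA hB
  unfold compressSet at h
  split_ifs at h with h₁ h₂ h₂
  · rw [← Finset.insert_erase h₁.1, ← Finset.insert_erase h₂.1, h]
  · exact absurd (h ▸ hB) h₁.2
  · exact absurd (h ▸ hA) h₂.2
  · exact h

/-- A cube rooted away from `i` survives the compression in direction `i`. -/
theorem mem_dComp_of_cube {i b : ℕ} {F : Finset (Finset ℕ)} {B : Finset ℕ} (hbi : b ≠ i)
    (h : ∀ C : Finset ℕ, {b} ⊆ C → C ⊆ B → C ∈ F) (C : Finset ℕ) (hbC : {b} ⊆ C)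
    (hCB : C ⊆ B) : C ∈ dComp i F := by
  rw [mem_dComp]
  by_cases hi : i ∈ C
  · refine Or.inl ⟨hi, h C hbC hCB, h _ ?_ ((Finset.erase_subset _ _).trans hCB)⟩
    rw [Finset.singleton_subset_iff] at hbC ⊢
    exact Finset.mem_erase.2 ⟨hbi, hbC⟩
  · exact Or.inr ⟨hi, Or.inl (h C hbC hCB)⟩

/-- Compressing a cube rooted at `i` in direction `i` yields a whole power set. -/
theorem mem_dComp_of_cube_self {i : ℕ} {F : Finset (Finset ℕ)} {B : Finset ℕ} (hi : i ∈ B)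
    (h : ∀ C : Finset ℕ, {i} ⊆ C → C ⊆ B → C ∈ F) (C : Finset ℕ) (hC : C ⊆ B.erase i) :
    C ∈ dComp i F := by
  rw [mem_dComp]
  refine Or.inr ⟨fun h' => Finset.notMem_erase i B (hC h'), Or.inr (h _ (by simp) ?_)⟩
  exact Finset.insert_subset hi (hC.trans (Finset.erase_subset _ _))

theorem simplyRooted_dComp {F : Finset (Finset ℕ)} (hF : SimplyRooted F) (i : ℕ) :
    SimplyRooted (dComp i F) := by
  intro B hB hne
  have hB' := hB
  rw [mem_dComp] at hB
  rcases hB with ⟨hi, hBF, hEF⟩ | ⟨hi, hBF | hBF⟩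
  · obtain ⟨b, hb, hcube⟩ := hF B hBF hne
    by_cases hbi : b = i
    · subst hbi
      rcases (B.erase b).eq_empty_or_nonempty with he | he
      · refine ⟨b, hb, fun C hbC hCB => ?_⟩
        have hBb : B ⊆ {b} := by
          rw [← Finset.insert_erase hb, he]; rfl
        rwa [hCB.antisymm (hBb.trans hbC)]
      · obtain ⟨c, hc, hcube'⟩ := hF _ hEF he
        have hc' := Finset.mem_erase.1 hc
        refine ⟨c, hc'.2, mem_dComp_of_cube hc'.1 fun C hcC hCB => ?_⟩
        by_cases hbC : b ∈ C
        · exact hcube C (Finset.singleton_subset_iff.2 hbC) hCB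
        · exact hcube' C hcC (Finset.subset_erase.2 ⟨hCB, hbC⟩)
    · exact ⟨b, hb, mem_dComp_of_cube hbi hcube⟩
  · obtain ⟨b, hb, hcube⟩ := hF B hBF hne
    exact ⟨b, hb, mem_dComp_of_cube (fun h => hi (h ▸ hb)) hcube⟩
  · obtain ⟨b, hb, hcube⟩ := hF _ hBF (Finset.insert_nonempty _ _)
    by_cases hbi : b = i
    · subst hbi
      obtain ⟨c, hc⟩ := hne
      refine ⟨c, hc, fun C _ hCB => mem_dComp_of_cube_self hb hcube C ?_⟩
      rwa [Finset.erase_insert hi]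
    · exact ⟨b, (Finset.mem_insert.1 hb).resolve_left hbi, fun C hbC hCB =>
        mem_dComp_of_cube hbi hcube C hbC (hCB.trans (Finset.subset_insert _ _))⟩

theorem simplyRooted_DComp {F : Finset (Finset ℕ)} (hF : SimplyRooted F) (k : ℕ) :
    SimplyRooted (DComp k F) := by
  induction k with
  | zero => exact hF
  | succ k ih => exact simplyRooted_dComp ih (k + 1)

theorem DComp_eq_image (k : ℕ) (F : Finset (Finset ℕ)) :
    DComp k F = F.image (DCompSet k F) := by
  induction k with
  | zero => ext A; simp [DComp, DCompSet]
  | succ k ih =>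
    calc DComp (k + 1) F = (DComp k F).image (compressSet (DComp k F) (k + 1)) := rfl
      _ = (F.image (DCompSet k F)).image (compressSet (DComp k F) (k + 1)) :=
        congrArg (Finset.image (compressSet (DComp k F) (k + 1))) ih
      _ = F.image (DCompSet (k + 1) F) := Finset.image_image

theorem DCompSet_mem_DComp {k : ℕ} {F : Finset (Finset ℕ)} {B : Finset ℕ} (hB : B ∈ F) :
    DCompSet k F B ∈ DComp k F := by
  rw [DComp_eq_image]
  exact Finset.mem_image_of_mem _ hB

theorem DCompSet_injOn (k : ℕ) (F : Finset (Finset ℕ)) :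
    Set.InjOn (DCompSet k F) (F : Set (Finset ℕ)) := by
  induction k with
  | zero => intro A _ B _ h; exact h
  | succ k ih =>
    intro A hA B hB h
    exact ih hA hB (compressSet_injOn (k + 1) _ (DCompSet_mem_DComp hA) (DCompSet_mem_DComp hB) h)

/-- In a simply rooted family each set loses at most one element, and once it has lost one
the whole power set below it is in the compressed family. -/
theorem SimplyRooted.DCompSet_eq_or {F : Finset (Finset ℕ)} (hF : SimplyRooted F)
    {B : Finset ℕ} (hB : B ∈ F) (k : ℕ) :
    DCompSet k F B = B ∨
      (B.card = (DCompSet k F B).card + 1 ∧ ∀ C ⊆ DCompSet k F B, C ∈ DComp k F) := by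
  induction k with
  | zero => exact Or.inl rfl
  | succ k ih =>
    have hmem : DCompSet k F B ∈ DComp k F := DCompSet_mem_DComp hB
    have hstep : DCompSet (k + 1) F B =
      compressSet (DComp k F) (k + 1) (DCompSet k F B) := rfl
    have hfam : DComp (k + 1) F = dComp (k + 1) (DComp k F) := rfl
    rw [hstep, hfam]
    rcases ih with ih | ⟨hcard, hdown⟩
    · rw [ih] at hmem ⊢
      unfold compressSet
      split_ifs with h
      · refine Or.inr ⟨(Finset.card_erase_add_one h.1).symm, ?_⟩
        obtain ⟨b, hb, hcube⟩ := simplyRooted_DComp hF k B hmem ⟨_, h.1⟩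
        have hbk : b = k + 1 := by
          by_contra hne
          exact h.2 (hcube _ (Finset.singleton_subset_iff.2 (Finset.mem_erase.2 ⟨hne, hb⟩))
            (Finset.erase_subset _ _))
        subst hbk
        exact mem_dComp_of_cube_self hb hcube
      · exact Or.inl rfl
    · have hfix : compressSet (DComp k F) (k + 1) (DCompSet k F B) = DCompSet k F B :=
        if_neg fun h => h.2 (hdown _ (Finset.erase_subset _ _))
      rw [hfix]
      refine Or.inr ⟨hcard, fun C hC => ?_⟩
      rw [mem_dComp]
      by_cases hi : k + 1 ∈ C
      · exact Or.inl ⟨hi, hdown C hC, hdown _ ((Finset.erase_subset _ _).trans hC)⟩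
      · exact Or.inr ⟨hi, Or.inl (hdown C hC)⟩

theorem DComp_subset_powerset {F : Finset (Finset ℕ)} {S : Finset ℕ} (hF : F ⊆ S.powerset)
    (k : ℕ) : DComp k F ⊆ S.powerset := by
  induction k with
  | zero => exact hF
  | succ k ih =>
    intro A hA
    have hA' : A ∈ dComp (k + 1) (DComp k F) := hA
    rw [mem_dComp] at hA'
    rcases hA' with ⟨_, h, _⟩ | ⟨_, h | h⟩
    · exact ih h
    · exact ih h
    · exact Finset.mem_powerset.2
        ((Finset.subset_insert _ _).trans (Finset.mem_powerset.1 (ih h)))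

theorem erase_mem_DComp (F : Finset (Finset ℕ)) (k j : ℕ) (hj : 1 ≤ j) (hjk : j ≤ k)
    (A : Finset ℕ) (hA : A ∈ DComp k F) : A.erase j ∈ DComp k F := by
  induction k generalizing A with
  | zero => omega
  | succ k ih =>
    have hfam : DComp (k + 1) F = dComp (k + 1) (DComp k F) := rfl
    rw [hfam, mem_dComp] at hA ⊢
    rcases Nat.lt_or_ge k j with h | h
    · obtain rfl : j = k + 1 := by omega
      rcases hA with ⟨_, _, h'⟩ | ⟨hn, h'⟩
      · exact Or.inr ⟨Finset.notMem_erase _ _, Or.inl h'⟩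
      · rw [Finset.erase_eq_of_notMem hn]
        exact Or.inr ⟨hn, h'⟩
    · have hne : k + 1 ≠ j := by omega
      rcases hA with ⟨hi, h₁, h₂⟩ | ⟨hi, h' | h'⟩
      · refine Or.inl ⟨Finset.mem_erase.2 ⟨hne, hi⟩, ih h _ h₁, ?_⟩
        rw [Finset.erase_right_comm]
        exact ih h _ h₂
      · exact Or.inr ⟨fun h'' => hi (Finset.mem_of_mem_erase h''), Or.inl (ih h _ h')⟩
      · refine Or.inr ⟨fun h'' => hi (Finset.mem_of_mem_erase h''), Or.inr ?_⟩
        have h₃ := ih h _ h'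
        rwa [Finset.erase_insert_of_ne hne] at h₃

theorem isDownSet_DComp {n : ℕ} {F : Finset (Finset ℕ)} (hF : F ⊆ (Finset.Icc 1 n).powerset) :
    IsDownSet (DComp n F) := by
  intro A hA
  induction A using Finset.strongInduction with
  | H A ih =>
    intro B hBA
    rcases hBA.eq_or_ssubset with rfl | hss
    · exact hA
    · obtain ⟨j, hjA, hjB⟩ := Finset.exists_of_ssubset hss
      have hj := Finset.mem_Icc.1 (Finset.mem_powerset.1 (DComp_subset_powerset hF n hA) hjA)
      exact ih _ (Finset.erase_ssubset hjA) (erase_mem_DComp F n j hj.1 hj.2 A hA) B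
        (Finset.subset_erase.2 ⟨hBA, hjB⟩)

theorem mem_colexSet (k i : ℕ) : i + 1 ∈ colexSet k ↔ k.testBit i = true := by
  simp only [colexSet, Finset.mem_image, Finset.mem_filter, Finset.mem_range,
    add_left_inj, exists_eq_right, and_iff_right_iff_imp]
  intro h
  have h₁ := Nat.ge_two_pow_of_testBit h
  have h₂ : i < 2 ^ i := Nat.lt_two_pow_self
  omega

theorem zero_notMem_colexSet (k : ℕ) : 0 ∉ colexSet k := by
  simp [colexSet]

theorem colexSet_injective : Function.Injective colexSet := by
  intro a b h
  apply Nat.eq_of_testBit_eq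
  intro i
  rw [Bool.eq_iff_iff, ← mem_colexSet, ← mem_colexSet, h]

theorem card_colexSet_two_mul (k : ℕ) : (colexSet (2 * k)).card = (colexSet k).card := by
  have h : colexSet (2 * k) = (colexSet k).image Nat.succ := by
    ext i
    rcases i with _ | _ | i
    · simp [zero_notMem_colexSet]
    · simp [mem_colexSet, zero_notMem_colexSet]
    · rw [mem_colexSet, Finset.mem_image]
      simp [Nat.testBit_succ, ← mem_colexSet]
  rw [h, Finset.card_image_of_injective _ Nat.succ_injective]

theorem card_colexSet_two_mul_add_one (k : ℕ) :
    (colexSet (2 * k + 1)).card = (colexSet k).card + 1 := by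
  have h : colexSet (2 * k + 1) = insert 1 ((colexSet k).image Nat.succ) := by
    ext i
    rcases i with _ | _ | i
    · simp [zero_notMem_colexSet]
    · simp [mem_colexSet]
    · rw [mem_colexSet, Finset.mem_insert, Finset.mem_image]
      have : (2 * k + 1) / 2 = k := by omega
      simp [Nat.testBit_succ, this, ← mem_colexSet]
  rw [h, Finset.card_insert_of_notMem (by simp [zero_notMem_colexSet]),
    Finset.card_image_of_injective _ Nat.succ_injective]

theorem totalSize_colexInit (m : ℕ) :
    totalSize (colexInit m) = ∑ k ∈ Finset.range m, (colexSet k).card :=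
  Finset.sum_image fun _ _ _ _ h => colexSet_injective h

theorem totalSize_colexInit_succ (m : ℕ) :
    totalSize (colexInit (m + 1)) = totalSize (colexInit m) + (colexSet m).card := by
  simp only [totalSize_colexInit, Finset.sum_range_succ]

theorem totalSize_colexInit_two_mul (m : ℕ) :
    totalSize (colexInit (2 * m)) = 2 * totalSize (colexInit m) + m := by
  induction m with
  | zero => simp [totalSize_colexInit]
  | succ m ih =>
    rw [show 2 * (m + 1) = 2 * m + 1 + 1 by ring, totalSize_colexInit_succ,
      totalSize_colexInit_succ, totalSize_colexInit_succ, ih, card_colexSet_two_mul,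
      card_colexSet_two_mul_add_one]
    ring

theorem totalSize_colexInit_two_mul_add_one (m : ℕ) :
    totalSize (colexInit (2 * m + 1)) =
      totalSize (colexInit m) + totalSize (colexInit (m + 1)) + m := by
  rw [totalSize_colexInit_succ, totalSize_colexInit_succ, totalSize_colexInit_two_mul,
    card_colexSet_two_mul]
  ring

theorem totalSize_colexInit_add_le (a b : ℕ) :
    totalSize (colexInit a) + totalSize (colexInit b) + min a b ≤
      totalSize (colexInit (a + b)) := by
  have h₀ : totalSize (colexInit 0) = 0 := by simp [totalSize_colexInit]
  induction hN : a + b using Nat.strong_induction_on generalizing a b with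
  | h N ih =>
    subst hN
    rcases Nat.eq_zero_or_pos a with rfl | ha
    · simp [h₀]
    rcases Nat.eq_zero_or_pos b with rfl | hb
    · simp [h₀]
    obtain ⟨c, rfl | rfl⟩ := Nat.even_or_odd' a <;> obtain ⟨d, rfl | rfl⟩ := Nat.even_or_odd' b
    · have h₁ := ih (c + d) (by omega) c d rfl
      rw [← mul_add]
      simp only [totalSize_colexInit_two_mul]
      omega
    · have h₁ := ih (c + d) (by omega) c d rfl
      have h₂ := ih (c + (d + 1)) (by omega) c (d + 1) rfl
      rw [show 2 * c + (2 * d + 1) = 2 * (c + d) + 1 by ring]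
      simp only [totalSize_colexInit_two_mul, totalSize_colexInit_two_mul_add_one]
      rw [← add_assoc c d 1] at h₂
      omega
    · have h₁ := ih (c + d) (by omega) c d rfl
      have h₂ := ih (c + 1 + d) (by omega) (c + 1) d rfl
      rw [show 2 * c + 1 + 2 * d = 2 * (c + d) + 1 by ring]
      simp only [totalSize_colexInit_two_mul, totalSize_colexInit_two_mul_add_one]
      rw [add_right_comm c 1 d] at h₂
      omega
    · have h₁ := ih (c + (d + 1)) (by omega) c (d + 1) rfl
      have h₂ := ih (c + 1 + d) (by omega) (c + 1) d rfl
      rw [show 2 * c + 1 + (2 * d + 1) = 2 * (c + d + 1) by ring]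
      simp only [totalSize_colexInit_two_mul, totalSize_colexInit_two_mul_add_one]
      rw [add_right_comm c 1 d] at h₂
      rw [← add_assoc c d 1] at h₁
      omega

theorem IsDownSet.totalSize_le {n : ℕ} {D : Finset (Finset ℕ)} (hD : IsDownSet D)
    (hsub : D ⊆ (Finset.Icc 1 n).powerset) : totalSize D ≤ totalSize (colexInit D.card) := by
  induction n generalizing D with
  | zero =>
    have h : totalSize D = 0 := by
      refine Finset.sum_eq_zero fun A hA => ?_
      have := hsub hA
      simpa using this
    omega
  | succ n ih =>
    set D₀ := D.filter fun A => n + 1 ∉ A with hD₀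
    set D₁ := (D.filter fun A => n + 1 ∈ A).image (fun A => A.erase (n + 1)) with hD₁
    have hinj : Set.InjOn (fun A : Finset ℕ => A.erase (n + 1))
        (D.filter fun A => n + 1 ∈ A : Finset (Finset ℕ)) := by
      intro A hA B hB h
      have hA' := (Finset.mem_filter.1 (Finset.mem_coe.1 hA)).2
      have hB' := (Finset.mem_filter.1 (Finset.mem_coe.1 hB)).2
      rw [← Finset.insert_erase hA', ← Finset.insert_erase hB']
      exact congrArg _ h
    have hcard₁ : D₁.card = (D.filter fun A => n + 1 ∈ A).card := Finset.card_image_of_injOn hinj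
    have hcard : D.card = D₀.card + D₁.card := by
      rw [hcard₁, add_comm]
      exact (Finset.card_filter_add_card_filter_not _).symm
    have hmem₁ : ∀ A, A ∈ D₁ ↔ n + 1 ∉ A ∧ insert (n + 1) A ∈ D := by
      intro A
      simp only [hD₁, Finset.mem_image, Finset.mem_filter]
      constructor
      · rintro ⟨B, ⟨hB, hn⟩, rfl⟩
        exact ⟨Finset.notMem_erase _ _, by rwa [Finset.insert_erase hn]⟩
      · rintro ⟨hn, hA⟩
        exact ⟨_, ⟨hA, Finset.mem_insert_self _ _⟩, Finset.erase_insert hn⟩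
    have hle : D₁ ⊆ D₀ := by
      intro A hA
      obtain ⟨hn, hA⟩ := (hmem₁ A).1 hA
      exact Finset.mem_filter.2 ⟨hD _ hA _ (Finset.subset_insert _ _), hn⟩
    have hsub₀ : D₀ ⊆ (Finset.Icc 1 n).powerset := by
      intro A hA
      obtain ⟨hA, hn⟩ := Finset.mem_filter.1 hA
      refine Finset.mem_powerset.2 fun x hx => ?_
      have h₁ := Finset.mem_Icc.1 (Finset.mem_powerset.1 (hsub hA) hx)
      have h₂ : x ≠ n + 1 := fun h => hn (h ▸ hx)
      exact Finset.mem_Icc.2 (by omega)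
    have hdown₀ : IsDownSet D₀ := by
      intro A hA B hBA
      obtain ⟨hA, hn⟩ := Finset.mem_filter.1 hA
      exact Finset.mem_filter.2 ⟨hD A hA B hBA, fun h => hn (hBA h)⟩
    have hdown₁ : IsDownSet D₁ := by
      intro A hA B hBA
      rw [hmem₁] at hA ⊢
      exact ⟨fun h => hA.1 (hBA h), hD _ hA.2 _ (Finset.insert_subset_insert _ hBA)⟩
    have hsize : totalSize D = totalSize D₀ + (totalSize D₁ + D₁.card) := by
      have h₁ : totalSize D₁ + D₁.card = ∑ A ∈ D.filter (fun A => n + 1 ∈ A), A.card := by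
        rw [hcard₁, totalSize, hD₁, Finset.sum_image hinj, Finset.card_eq_sum_ones,
          ← Finset.sum_add_distrib]
        exact Finset.sum_congr rfl fun A hA =>
          Finset.card_erase_add_one (Finset.mem_filter.1 hA).2
      rw [h₁, add_comm]
      exact (Finset.sum_filter_add_sum_filter_not D _ _).symm
    have h₀ := ih hdown₀ hsub₀
    have h₁ := ih hdown₁ (hle.trans hsub₀)
    have h₂ := totalSize_colexInit_add_le D₀.card D₁.card
    have h₃ := Finset.card_le_card hle
    rw [min_eq_right h₃] at h₂
    rw [hcard]
    omega

/-- For a simply rooted family `ℬ ⊆ 𝒫(n)` with `|ℬ| = m` and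
`m'` the number of `B ∈ ℬ` with `d_ℬ(B) = B`, we have `‖ℬ‖ ≤ ‖I(m)‖ + m - m'`. -/
theorem stmt10 (n : ℕ) (ℬ : Finset (Finset ℕ)) (hsub : ℬ ⊆ (Finset.Icc 1 n).powerset)
    (hsr : SimplyRooted ℬ) (m m' : ℕ) (hm : m = ℬ.card)
    (hm' : m' = (ℬ.filter fun B => DCompSet n ℬ B = B).card) :
    (totalSize ℬ : ℤ) ≤ (totalSize (colexInit m) : ℤ) + (m : ℤ) - (m' : ℤ) := by
  subst hm hm'
  have hbound : totalSize (DComp n ℬ) ≤ totalSize (colexInit ℬ.card) := by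
    have h := (isDownSet_DComp hsub).totalSize_le (DComp_subset_powerset hsub n)
    rwa [show (DComp n ℬ).card = ℬ.card by
      rw [DComp_eq_image, Finset.card_image_of_injOn (DCompSet_injOn n ℬ)]] at h
  have hsum : totalSize (DComp n ℬ) = ∑ B ∈ ℬ, (DCompSet n ℬ B).card := by
    rw [DComp_eq_image, totalSize, Finset.sum_image (DCompSet_injOn n ℬ)]
  have hloss : totalSize ℬ + (ℬ.filter fun B => DCompSet n ℬ B = B).card ≤
      ∑ B ∈ ℬ, (DCompSet n ℬ B).card + ℬ.card := by
    rw [totalSize, Finset.card_filter, Finset.card_eq_sum_ones, ← Finset.sum_add_distrib,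
      ← Finset.sum_add_distrib]
    refine Finset.sum_le_sum fun B hB => ?_
    split_ifs with h
    · rw [h]
    · have := ((hsr.DCompSet_eq_or hB n).resolve_left h).1
      omega
  omega
end

section
/- Let ℬ ⊆ 𝒫(n) be a simply rooted family, and let B ∈ ℬ be such that B∖{b} ∉ ℬ for some b ∈ B. Then d_ℬ(B) ∈ {B, B∖{b}}. -/
open Finset
open scoped Classical

theorem erase_mem_dComp {ℬ : Finset (Finset ℕ)} {A : Finset ℕ} (i : ℕ) (hA : A ∈ ℬ) :
    A.erase i ∈ dComp i ℬ := by
  refine mem_image.2 ?_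
  by_cases h : A.erase i ∈ ℬ
  · exact ⟨A.erase i, h, by simp [compressSet]⟩
  · by_cases hi : i ∈ A
    · exact ⟨A, hA, by simp [compressSet, hi, h]⟩
    · exact absurd (by rwa [erase_eq_of_notMem hi]) h

theorem mem_dComp_of_mem_of_erase_mem {ℬ : Finset (Finset ℕ)} {A : Finset ℕ} {i : ℕ}
    (hA : A ∈ ℬ) (h : A.erase i ∈ ℬ) : A ∈ dComp i ℬ :=
  mem_image.2 ⟨A, hA, by simp [compressSet, h]⟩

theorem exists_superset_of_mem_DComp {ℬ : Finset (Finset ℕ)} {k : ℕ} :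
    ∀ {A : Finset ℕ}, A ∈ DComp k ℬ →
      ∃ Y ∈ ℬ, A ⊆ Y ∧ ∀ y ∈ Y, y ∉ A → 1 ≤ y ∧ y ≤ k := by
  induction k with
  | zero => exact fun {A} hA => ⟨A, hA, Subset.rfl, fun y hy hn => absurd hy hn⟩
  | succ k ih =>
    intro A hA
    obtain ⟨A', hA', rfl⟩ := mem_image.1 hA
    obtain ⟨Y, hY, hAY, hYk⟩ := ih hA'
    refine ⟨Y, hY, ?_, ?_⟩
    · unfold compressSet
      split_ifs
      · exact (erase_subset _ _).trans hAY
      · exact hAY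
    · intro y hy hn
      by_cases hyA : y ∈ A'
      · have : y = k + 1 := by
          by_contra hne
          apply hn
          unfold compressSet
          split_ifs
          · exact mem_erase.2 ⟨hne, hyA⟩
          · exact hyA
        omega
      · have := hYk y hy hyA
        omega

theorem powerset_subset_DComp {ℬ : Finset (Finset ℕ)} {S : Finset ℕ} {k m : ℕ} (hkm : k ≤ m)
    (h : S.powerset ⊆ DComp k ℬ) : S.powerset ⊆ DComp m ℬ := by
  induction m, hkm using Nat.le_induction with
  | base => exact h
  | succ m _ ih =>
    intro C hC
    refine mem_dComp_of_mem_of_erase_mem (ih hC) (ih ?_)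
    exact mem_powerset.2 ((erase_subset _ _).trans (mem_powerset.1 hC))

theorem DCompSet_eq_of_powerset_subset {ℬ : Finset (Finset ℕ)} {B S : Finset ℕ} {k m : ℕ}
    (hkm : k ≤ m) (h : S.powerset ⊆ DComp k ℬ) (hS : DCompSet k ℬ B = S) :
    DCompSet m ℬ B = S := by
  induction m, hkm using Nat.le_induction with
  | base => exact hS
  | succ m hkm ih =>
    have := powerset_subset_DComp hkm h (mem_powerset.2 (erase_subset (m + 1) S))
    simp [DCompSet, ih, compressSet, this]

theorem RootedAt.rootedAt_DComp {ℬ : Finset (Finset ℕ)} {Y : Finset ℕ} {x k : ℕ}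
    (h : RootedAt ℬ Y x) (hk : k < x) : RootedAt (DComp k ℬ) Y x := by
  induction k with
  | zero => exact h
  | succ k ih =>
    have ih := ih (by omega)
    refine ⟨h.1, fun C hxC hC => ?_⟩
    refine mem_dComp_of_mem_of_erase_mem (ih.2 C hxC hC)
      (ih.2 _ ?_ ((erase_subset _ _).trans hC))
    rw [singleton_subset_iff] at hxC ⊢
    exact mem_erase.2 ⟨by omega, hxC⟩

theorem RootedAt.powerset_erase_subset_DComp {ℬ : Finset (Finset ℕ)} {Y : Finset ℕ} {x k : ℕ}
    (h : RootedAt ℬ Y x) (hx : 1 ≤ x) (hk : x ≤ k) : (Y.erase x).powerset ⊆ DComp k ℬ := by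
  obtain ⟨j, rfl⟩ : ∃ j, x = j + 1 := ⟨x - 1, by omega⟩
  refine powerset_subset_DComp hk fun C hC => ?_
  have hC := mem_powerset.1 hC
  have hxC : j + 1 ∉ C := fun hm => by simpa using hC hm
  have := erase_mem_dComp (j + 1)
    ((h.rootedAt_DComp (Nat.lt_succ_self j)).2 (insert (j + 1) C) (by simp)
      (insert_subset h.1 (hC.trans (erase_subset _ _))))
  rwa [erase_insert hxC] at this

theorem RootedAt.DCompSet_eq {ℬ : Finset (Finset ℕ)} {B : Finset ℕ} {b k : ℕ}
    (h : RootedAt ℬ B b) (hk : k < b) : DCompSet k ℬ B = B := by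
  induction k with
  | zero => rfl
  | succ k ih =>
    have hmem : B.erase (k + 1) ∈ DComp k ℬ :=
      (h.rootedAt_DComp (Nat.lt_of_succ_lt hk)).2 _
        (singleton_subset_iff.2 (mem_erase.2 ⟨by omega, h.1⟩)) (erase_subset _ _)
    simp [DCompSet, ih (by omega), compressSet, hmem]

theorem SimplyRooted.rootedAt_of_erase_notMem {ℬ : Finset (Finset ℕ)} (hsr : SimplyRooted ℬ)
    {B : Finset ℕ} {b : ℕ} (hB : B ∈ ℬ) (hb : b ∈ B) (hout : B.erase b ∉ ℬ) :
    RootedAt ℬ B b := by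
  obtain ⟨c, hc, hcube⟩ := hsr B hB ⟨b, hb⟩
  obtain rfl : c = b := by
    by_contra hne
    exact hout (hcube _ (singleton_subset_iff.2 (mem_erase.2 ⟨hne, hc⟩)) (erase_subset _ _))
  exact ⟨hc, hcube⟩

/-- A set outside a simply rooted family can only enter it under the compressions together with
all of its subsets. -/
theorem SimplyRooted.powerset_subset_DComp_of_notMem {ℬ : Finset (Finset ℕ)}
    (hsr : SimplyRooted ℬ) {A : Finset ℕ} {k : ℕ} (hA : A ∉ ℬ) (hk : A ∈ DComp k ℬ) :
    A.powerset ⊆ DComp k ℬ := by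
  obtain ⟨Y, hY, hAY, hYk⟩ := exists_superset_of_mem_DComp hk
  have hne : Y.Nonempty := by
    rw [nonempty_iff_ne_empty]
    rintro rfl
    exact hA (by rwa [subset_empty.1 hAY])
  obtain ⟨x, hx, hcube⟩ := hsr Y hY hne
  have hxA : x ∉ A := fun h => hA (hcube A (singleton_subset_iff.2 h) hAY)
  obtain ⟨h1, h2⟩ := hYk x hx hxA
  exact (powerset_mono.2 (subset_erase.2 ⟨hAY, hxA⟩)).trans
    (RootedAt.powerset_erase_subset_DComp ⟨hx, hcube⟩ h1 h2)

/-- Let `ℬ ⊆ 𝒫(n)` be simply rooted and `B ∈ ℬ` with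
`B \ {b} ∉ ℬ` for some `b ∈ B`. Then `d_ℬ(B) ∈ {B, B \ {b}}`. -/
theorem stmt14 (n : ℕ) (ℬ : Finset (Finset ℕ)) (hsub : ℬ ⊆ (Finset.Icc 1 n).powerset)
    (hsr : SimplyRooted ℬ) (B : Finset ℕ) (hBmem : B ∈ ℬ)
    (b : ℕ) (hb : b ∈ B) (hout : B.erase b ∉ ℬ) :
    DCompSet n ℬ B = B ∨ DCompSet n ℬ B = B.erase b := by
  have hroot := hsr.rootedAt_of_erase_notMem hBmem hb hout
  obtain ⟨h1, hn⟩ := Finset.mem_Icc.1 (mem_powerset.1 (hsub hBmem) hb)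
  obtain ⟨j, rfl⟩ : ∃ j, b = j + 1 := ⟨b - 1, by omega⟩
  have hj : DCompSet j ℬ B = B := hroot.DCompSet_eq (Nat.lt_succ_self j)
  by_cases hmem : B.erase (j + 1) ∈ DComp j ℬ
  · left
    refine DCompSet_eq_of_powerset_subset (Nat.le_of_succ_le hn) (fun C hC => ?_) hj
    have hC := mem_powerset.1 hC
    by_cases hjC : j + 1 ∈ C
    · exact (hroot.rootedAt_DComp (Nat.lt_succ_self j)).2 C (singleton_subset_iff.2 hjC) hC
    · exact hsr.powerset_subset_DComp_of_notMem hout hmem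
        (mem_powerset.2 (subset_erase.2 ⟨hC, hjC⟩))
  · right
    refine DCompSet_eq_of_powerset_subset hn
      (hroot.powerset_erase_subset_DComp h1 le_rfl) ?_
    simp [DCompSet, hj, compressSet, hb, hmem]
end
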